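/- arXiv:0901.2897 — 2 statements merged into one kernel-verified Lean document; each statement's English description precedes it below -/
import Mathlib

section
/- For any word w of length n and any index 1 ≤ i ≤ n−1: if π_w[i+1] = π_w[i]+1 then π'_w[i] = π'_w[π_w[i]], and otherwise π'_w[i] = π_w[i] (where π'_w[0] = −1). In particular, π_w uniquely determines π'_w without any access to the letters of w. -/
/- A word over alphabet `α` is modelled as `w : ℕ → α`, indexed `w 1, …, w n`. -/

/-- `IsBorder w i b`: `b` is the length of a border (possibly non-proper) of the
prefix `w[1..i]`, i.e. `b ≤ i` and `w[1..b] = w[i-b+1..i]`. -/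
def IsBorder {α : Type*} (w : ℕ → α) (i b : ℕ) : Prop :=
  b ≤ i ∧ ∀ t, 1 ≤ t → t ≤ b → w t = w (i - b + t)

/-- The failure function (border array) `π_w[i]`: the length of the longest proper
border of `w[1..i]`. -/
noncomputable def piF {α : Type*} (w : ℕ → α) (i : ℕ) : ℕ :=
  sSup {b | b < i ∧ IsBorder w i b}

/- The strong failure function `π'_w[i]` of a word of length `n`, valued in `ℤ`:
`π'_w[n] = π_w[n]`, and for `i < n` the length of the longest proper border `b` of
`w[1..i]` with `w[b+1] ≠ w[i+1]`, or `-1` if no such border exists. -/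
open Classical in
noncomputable def piF' {α : Type*} (w : ℕ → α) (n i : ℕ) : ℤ :=
  if i = n then (piF w i : ℤ)
  else if ({b | b < i ∧ IsBorder w i b ∧ w (b + 1) ≠ w (i + 1)} : Set ℕ).Nonempty
    then ((sSup {b | b < i ∧ IsBorder w i b ∧ w (b + 1) ≠ w (i + 1)} : ℕ) : ℤ)
    else -1

theorem isBorder_zero {α : Type*} (w : ℕ → α) (i : ℕ) : IsBorder w i 0 :=
  ⟨Nat.zero_le i, fun t h₁ h₂ => by omega⟩

theorem isBorder_succ_iff {α : Type*} {w : ℕ → α} {i b : ℕ} :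
    IsBorder w (i + 1) (b + 1) ↔ IsBorder w i b ∧ w (b + 1) = w (i + 1) := by
  constructor
  · rintro ⟨hle, h⟩
    refine ⟨⟨by omega, fun t h₁ h₂ => ?_⟩, ?_⟩
    · rw [h t h₁ (by omega)]
      congr 1
      omega
    · rw [h (b + 1) (by omega) le_rfl]
      congr 1
      omega
  · rintro ⟨⟨hle, h⟩, heq⟩
    refine ⟨by omega, fun t h₁ h₂ => ?_⟩
    obtain rfl | hlt := h₂.eq_or_lt
    · rw [heq]
      congr 1
      omega
    · rw [h t h₁ (by omega)]
      congr 1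
      omega

theorem IsBorder.trans {α : Type*} {w : ℕ → α} {i m b : ℕ} (hm : IsBorder w i m)
    (hb : IsBorder w m b) : IsBorder w i b := by
  obtain ⟨hmi, hm⟩ := hm
  obtain ⟨hbm, hb⟩ := hb
  refine ⟨hbm.trans hmi, fun t h₁ h₂ => ?_⟩
  rw [hb t h₁ h₂, hm (m - b + t) (by omega) (by omega)]
  congr 1
  omega

theorem IsBorder.of_le {α : Type*} {w : ℕ → α} {i m b : ℕ} (hm : IsBorder w i m)
    (hb : IsBorder w i b) (hbm : b ≤ m) : IsBorder w m b := by
  obtain ⟨hmi, hm⟩ := hm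
  obtain ⟨-, hb⟩ := hb
  refine ⟨hbm, fun t h₁ h₂ => ?_⟩
  rw [hb t h₁ h₂, hm (m - b + t) (by omega) (by omega)]
  congr 1
  omega

theorem bddAbove_properBorders {α : Type*} (w : ℕ → α) (i : ℕ) :
    BddAbove {b | b < i ∧ IsBorder w i b} :=
  ⟨i, fun _ hb => hb.1.le⟩

theorem piF_spec {α : Type*} (w : ℕ → α) {i : ℕ} (hi : 1 ≤ i) :
    piF w i < i ∧ IsBorder w i (piF w i) :=
  Nat.sSup_mem (s := {b | b < i ∧ IsBorder w i b}) ⟨0, hi, isBorder_zero w i⟩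
    (bddAbove_properBorders w i)

theorem IsBorder.le_piF {α : Type*} {w : ℕ → α} {i b : ℕ} (hb : IsBorder w i b) (hlt : b < i) :
    b ≤ piF w i :=
  le_csSup (bddAbove_properBorders w i) ⟨hlt, hb⟩

theorem piF_succ_eq_iff {α : Type*} (w : ℕ → α) {i : ℕ} (hi : 1 ≤ i) :
    piF w (i + 1) = piF w i + 1 ↔ w (piF w i + 1) = w (i + 1) := by
  obtain ⟨hlt, hb⟩ := piF_spec w hi
  obtain ⟨hlt', hb'⟩ := piF_spec w (Nat.le_add_left 1 i)
  constructor
  · intro h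
    rw [h] at hb'
    exact (isBorder_succ_iff.1 hb').2
  · intro h
    refine le_antisymm ?_ ((isBorder_succ_iff.2 ⟨hb, h⟩).le_piF (by omega))
    cases hk : piF w (i + 1) with
    | zero => exact Nat.zero_le _
    | succ k =>
      rw [hk] at hb' hlt'
      exact Nat.succ_le_succ ((isBorder_succ_iff.1 hb').1.le_piF (by omega))

theorem piF'_self {α : Type*} (w : ℕ → α) (n : ℕ) : piF' w n n = piF w n := if_pos rfl

theorem piF'_zero {α : Type*} (w : ℕ → α) {n : ℕ} (hn : 1 ≤ n) : piF' w n 0 = -1 := by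
  rw [piF', if_neg (by omega), if_neg]
  rintro ⟨b, hb, -⟩
  exact Nat.not_lt_zero b hb

theorem piF'_eq_piF' {α : Type*} (w : ℕ → α) {n i : ℕ} (hi : 1 ≤ i) (hin : i < n)
    (h : piF w (i + 1) = piF w i + 1) : piF' w n i = piF' w n (piF w i) := by
  obtain ⟨hlt, hm⟩ := piF_spec w hi
  have heq := (piF_succ_eq_iff w hi).1 h
  have hset : {b | b < i ∧ IsBorder w i b ∧ w (b + 1) ≠ w (i + 1)} =
      {b | b < piF w i ∧ IsBorder w (piF w i) b ∧ w (b + 1) ≠ w (piF w i + 1)} := by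
    ext b
    simp only [Set.mem_ofPred_eq, heq]
    constructor
    · rintro ⟨hbi, hb, hne⟩
      have hle := hb.le_piF hbi
      refine ⟨lt_of_le_of_ne hle ?_, hm.of_le hb hle, hne⟩
      rintro rfl
      exact hne heq
    · rintro ⟨hbm, hb, hne⟩
      exact ⟨hbm.trans hlt, hm.trans hb, hne⟩
  rw [piF', piF', if_neg hin.ne, if_neg (hlt.trans hin).ne, hset]

theorem piF'_eq_piF {α : Type*} (w : ℕ → α) {n i : ℕ} (hi : 1 ≤ i) (hin : i < n)
    (h : piF w (i + 1) ≠ piF w i + 1) : piF' w n i = piF w i := by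
  obtain ⟨hlt, hm⟩ := piF_spec w hi
  have hgreatest : IsGreatest {b | b < i ∧ IsBorder w i b ∧ w (b + 1) ≠ w (i + 1)} (piF w i) :=
    ⟨⟨hlt, hm, fun he => h ((piF_succ_eq_iff w hi).2 he)⟩, fun _ hb => hb.2.1.le_piF hb.1⟩
  rw [piF', if_neg hin.ne, if_pos ⟨_, hgreatest.1⟩, hgreatest.csSup_eq]

theorem piF'_congr {α β : Type*} (w : ℕ → α) (v : ℕ → β) {n : ℕ}
    (h : ∀ i, 1 ≤ i → i ≤ n → piF w i = piF v i) {i : ℕ} (hi : 1 ≤ i) (hin : i ≤ n) :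
    piF' w n i = piF' v n i := by
  induction i using Nat.strong_induction_on with
  | _ i ih =>
    have hπ := h i hi hin
    obtain rfl | hlt := hin.eq_or_lt
    · rw [piF'_self, piF'_self, hπ]
    · have hπ' := h (i + 1) (by omega) hlt
      by_cases hs : piF w (i + 1) = piF w i + 1
      · rw [piF'_eq_piF' w hi hlt hs, piF'_eq_piF' v hi hlt (by rw [← hπ, ← hπ', hs]), ← hπ]
        have hm := (piF_spec w hi).1
        obtain h0 | hpos := Nat.eq_zero_or_pos (piF w i)
        · rw [h0, piF'_zero w (hi.trans hin), piF'_zero v (hi.trans hin)]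
        · exact ih _ hm hpos (hm.le.trans hin)
      · rw [piF'_eq_piF w hi hlt hs, piF'_eq_piF v hi hlt (by rwa [← hπ, ← hπ']), hπ]

/-- For `1 ≤ i ≤ n-1`: if `π_w[i+1] = π_w[i]+1` then `π'_w[i] = π'_w[π_w[i]]`, and
otherwise `π'_w[i] = π_w[i]` (with `π'_w[0] = -1`).  In particular `π_w` uniquely
determines `π'_w` without any access to the letters of `w`. -/
theorem pi'_from_pi {α β : Type*} (w : ℕ → α) (n : ℕ) :
    (∀ i, 1 ≤ i → i ≤ n - 1 →
      if piF w (i + 1) = piF w i + 1 then piF' w n i = piF' w n (piF w i)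
      else piF' w n i = (piF w i : ℤ)) ∧
    (∀ v : ℕ → β, (∀ i, 1 ≤ i → i ≤ n → piF w i = piF v i) →
      ∀ i, 1 ≤ i → i ≤ n → piF' w n i = piF' v n i) := by
  refine ⟨fun i hi hin => ?_, fun v h i hi hin => piF'_congr w v h hi hin⟩
  split_ifs with h
  · exact piF'_eq_piF' w hi (by omega) h
  · exact piF'_eq_piF w hi (by omega) h
end

section
/- Let w be a word of length n and define f'(i) = π'_w[i−1] + 1 for 2 ≤ i ≤ n (defined when π'_w[i−1] ≥ 0), with iterates f'^{(k)} defined while all intermediate values are ≥ 2. Then for every index 2 ≤ i ≤ n and every k ≥ 1 for which f'^{(k)}(i) is defined, k ≤ 3·⌊log₂ i⌋ + 2. In particular, the depth of the forest T' (with edges i → f'(i)) on a word of length n is O(log n). -/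
/-- `f'(i) = π'_w[i-1] + 1` (meaningful when `2 ≤ i` and `π'_w[i-1] ≥ 0`). -/
noncomputable def fF' {α : Type*} (w : ℕ → α) (n i : ℕ) : ℕ :=
  (piF' w n (i - 1) + 1).toNat

/-- `fDef' w n i k`: the iterate `f'^{(k)}(i)` is defined, i.e. all the intermediate
arguments are `≥ 2` and the corresponding values of `π'` are `≥ 0`. -/
def fDef' {α : Type*} (w : ℕ → α) (n i k : ℕ) : Prop :=
  ∀ j < k, 2 ≤ (fF' w n)^[j] i ∧ 0 ≤ piF' w n ((fF' w n)^[j] i - 1)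

/-- Where the strong failure function is nonnegative inside the word, its value is a proper border
followed by a mismatching letter. -/
theorem exists_border_of_piF'_nonneg {α : Type*} {w : ℕ → α} {n m : ℕ} (hm : m < n)
    (h : 0 ≤ piF' w n m) :
    ∃ b : ℕ, piF' w n m = b ∧ b < m ∧ IsBorder w m b ∧ w (b + 1) ≠ w (m + 1) := by
  unfold piF' at h ⊢
  rw [if_neg hm.ne] at h ⊢
  split_ifs at h ⊢ with hne
  · exact ⟨_, rfl, Nat.sSup_mem hne ⟨m, fun b hb => hb.1.le⟩⟩
  · omega

theorem exists_border_of_fF' {α : Type*} {w : ℕ → α} {n i : ℕ} (h1 : 2 ≤ i) (h2 : i ≤ n)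
    (h : 0 ≤ piF' w n (i - 1)) :
    ∃ b : ℕ, fF' w n i = b + 1 ∧ b < i - 1 ∧ IsBorder w (i - 1) b ∧ w (b + 1) ≠ w i := by
  obtain ⟨b, hb, hlt, hbord, hne⟩ := exists_border_of_piF'_nonneg (by omega : i - 1 < n) h
  rw [show i - 1 + 1 = i by omega] at hne
  exact ⟨b, by rw [fF', hb]; omega, hlt, hbord, hne⟩

/-- If a border `b` of the prefix of length `m` has itself a border `c` that is followed by a
different letter than `b`, then `b + c < m`. -/
theorem IsBorder.add_lt {α : Type*} {w : ℕ → α} {m b c : ℕ} (hb : IsBorder w m b) (hbm : b < m)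
    (hc : IsBorder w b c) (hcb : c < b) (hne : w (c + 1) ≠ w (b + 1)) : b + c < m := by
  by_contra! hlt
  have e1 := hb.2 (b + 1 - (m - b)) (by omega) (by omega)
  have e2 := hb.2 (c + 1 - (m - b)) (by omega) (by omega)
  have e3 := hc.2 (c + 1 - (m - b)) (by omega) (by omega)
  rw [show m - b + (b + 1 - (m - b)) = b + 1 by omega] at e1
  rw [show m - b + (c + 1 - (m - b)) = c + 1 by omega] at e2
  rw [show b - c + (c + 1 - (m - b)) = b + 1 - (m - b) by omega] at e3
  exact hne (e2.symm.trans (e3.trans e1))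

theorem fDef'.of_succ {α : Type*} {w : ℕ → α} {n i k : ℕ} (h : fDef' w n i (k + 1)) :
    fDef' w n (fF' w n i) k :=
  fun j hj => h (j + 1) (by omega)

/-- Two steps of `f'` at least halve the index. -/
theorem two_mul_fF'_fF'_le {α : Type*} {w : ℕ → α} {n i : ℕ} (hi : i ≤ n)
    (h : fDef' w n i 2) : 2 * fF' w n (fF' w n i) ≤ i := by
  obtain ⟨hi2, hpi⟩ : 2 ≤ i ∧ 0 ≤ piF' w n (i - 1) := h 0 (by omega)
  obtain ⟨hf2, hpf⟩ : 2 ≤ fF' w n i ∧ 0 ≤ piF' w n (fF' w n i - 1) := h 1 (by omega)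
  obtain ⟨b, hb, hbi, hbord, -⟩ := exists_border_of_fF' hi2 hi hpi
  obtain ⟨c, hc, hcb, hcbord, hne⟩ := exists_border_of_fF' hf2 (by omega) hpf
  rw [hb, Nat.add_sub_cancel] at hcb hcbord
  rw [hb] at hne
  have := hbord.add_lt hbi hcbord hcb hne
  omega

/-- For every `2 ≤ i ≤ n` and every `k ≥ 1` for which `f'^{(k)}(i)` is defined,
`k ≤ 3·⌊log₂ i⌋ + 2`.  In particular, the depth of the forest `T'` on a word of
length `n` is `O(log n)`. -/
theorem depth_T'_log {α : Type*} (w : ℕ → α) (n i k : ℕ)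
    (h1 : 2 ≤ i) (h2 : i ≤ n) (hk : 1 ≤ k) (hdef : fDef' w n i k) :
    k ≤ 3 * Nat.log 2 i + 2 := by
  induction k using Nat.strong_induction_on generalizing i with
  | _ k ih =>
    by_cases hk2 : k ≤ 2
    · omega
    obtain ⟨l, rfl⟩ : ∃ l, k = l + 2 := ⟨k - 2, by omega⟩
    have hhalf := two_mul_fF'_fF'_le h2 fun j hj => hdef j (by omega)
    have hdef' := hdef.of_succ.of_succ
    have hge : 2 ≤ fF' w n (fF' w n i) := (hdef' 0 (by omega)).1
    have hrec := ih l (by omega) _ hge (by omega) (by omega) hdef'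
    have hlog : Nat.log 2 (fF' w n (fF' w n i)) + 1 ≤ Nat.log 2 i := by
      rw [← Nat.log_mul_base (by omega) (by omega)]
      exact Nat.log_mono_right (by omega)
    omega
end
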